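/- Let R, b, u, h, b', D, η, ψ, M be real numbers with η > 0, ψ ≥ 0, u ≥ 0, h ≥ 0, b' ≥ 0, and suppose M ≥ |R − b|, M ≥ |D − (u + b)/η|, M ≥ ψ·|D − (u + b)/η|, and M ≥ |(u + b) − D·η|. Then the triple (u, h, b') satisfies the nonlinear decision-rule equations u = max(R − b, 0), h = max((D − (u + b)/η)·ψ, 0), and b' = max((u + b) − D·η, 0) if and only if there exist α, β ∈ {0, 1} such that all of the following linear constraints hold: u ≥ R − b, u ≤ M·β + (R − b), u ≤ M·(1 − β), b − R ≥ M·(β − 1), b − R ≤ M·β, h ≥ (D − (u + b)/η)·ψ, h ≤ M·(1 − α) + (D − (u + b)/η)·ψ, h ≤ M·α, b' ≥ (u + b) − D·η, b' ≤ M·α + ((u + b) − D·η), b' ≤ M·(1 − α), D − (u + b)/η ≥ M·(α − 1), and D − (u + b)/η ≤ M·α. -/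

import Mathlib

theorem stmt_5 (R b u h b' D η ψ M : ℝ)
    (hη : η > 0) (hψ : ψ ≥ 0) (hu : u ≥ 0) (hh : h ≥ 0) (hb' : b' ≥ 0)
    (hM1 : M ≥ |R - b|)
    (hM2 : M ≥ |D - (u + b) / η|)
    (hM3 : M ≥ ψ * |D - (u + b) / η|)
    (hM4 : M ≥ |(u + b) - D * η|) :
    (u = max (R - b) 0 ∧
     h = max ((D - (u + b) / η) * ψ) 0 ∧
     b' = max ((u + b) - D * η) 0) ↔
    (∃ α β : ℝ, (α = 0 ∨ α = 1) ∧ (β = 0 ∨ β = 1) ∧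
      u ≥ R - b ∧
      u ≤ M * β + (R - b) ∧
      u ≤ M * (1 - β) ∧
      b - R ≥ M * (β - 1) ∧
      b - R ≤ M * β ∧
      h ≥ (D - (u + b) / η) * ψ ∧
      h ≤ M * (1 - α) + (D - (u + b) / η) * ψ ∧
      h ≤ M * α ∧
      b' ≥ (u + b) - D * η ∧
      b' ≤ M * α + ((u + b) - D * η) ∧
      b' ≤ M * (1 - α) ∧
      D - (u + b) / η ≥ M * (α - 1) ∧
      D - (u + b) / η ≤ M * α) := by 
  have he : (u + b) - D * η = -(η * (D - (u + b) / η)) := by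
    field_simp
    ring
  rw [he] at hM4 ⊢
  generalize D - (u + b) / η = t at *
  have hs : |t * ψ| ≤ M := by rwa [abs_mul, abs_of_nonneg hψ, mul_comm]
  have hpos : 0 ≤ t → 0 ≤ t * ψ ∧ 0 ≤ η * t := fun ht =>
    ⟨mul_nonneg ht hψ, mul_nonneg hη.le ht⟩
  have hneg : t ≤ 0 → t * ψ ≤ 0 ∧ η * t ≤ 0 := fun ht =>
    ⟨mul_nonpos_of_nonpos_of_nonneg ht hψ, mul_nonpos_of_nonneg_of_nonpos hη.le ht⟩
  generalize t * ψ = s at *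
  generalize η * t = e at *
  obtain ⟨hRb₁, hRb₂⟩ := abs_le.mp hM1
  obtain ⟨ht₁, ht₂⟩ := abs_le.mp hM2
  obtain ⟨he₁, he₂⟩ := abs_le.mp hM4
  obtain ⟨hs₁, hs₂⟩ := abs_le.mp hs
  constructor
  · rintro ⟨hu_eq, hh_eq, hb_eq⟩
    have hα : ∃ α : ℝ, (α = 0 ∧ t ≤ 0) ∨ (α = 1 ∧ 0 ≤ t) := by
      rcases le_total t 0 with ht | ht
      · exact ⟨0, Or.inl ⟨rfl, ht⟩⟩
      · exact ⟨1, Or.inr ⟨rfl, ht⟩⟩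
    have hβ : ∃ β : ℝ, (β = 0 ∧ b ≤ R) ∨ (β = 1 ∧ R ≤ b) := by
      rcases le_total b R with hR | hR
      · exact ⟨0, Or.inl ⟨rfl, hR⟩⟩
      · exact ⟨1, Or.inr ⟨rfl, hR⟩⟩
    obtain ⟨α, hα⟩ := hα
    obtain ⟨β, hβ⟩ := hβ
    refine ⟨α, β, hα.imp And.left And.left, hβ.imp And.left And.left, ?_⟩
    have hu_bounds : u ≥ R - b ∧ u ≤ M * β + (R - b) ∧ u ≤ M * (1 - β) ∧
        b - R ≥ M * (β - 1) ∧ b - R ≤ M * β := by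
      rcases hβ with ⟨rfl, hR⟩ | ⟨rfl, hR⟩
      · rw [max_eq_left (by linarith)] at hu_eq
        refine ⟨?_, ?_, ?_, ?_, ?_⟩ <;> linarith
      · rw [max_eq_right (by linarith)] at hu_eq
        refine ⟨?_, ?_, ?_, ?_, ?_⟩ <;> linarith
    obtain ⟨h₁, h₂, h₃, h₄, h₅⟩ := hu_bounds
    refine ⟨h₁, h₂, h₃, h₄, h₅, ?_⟩
    rcases hα with ⟨rfl, ht⟩ | ⟨rfl, ht⟩
    · obtain ⟨hst, het⟩ := hneg ht
      rw [max_eq_right hst] at hh_eq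
      rw [max_eq_left (by linarith)] at hb_eq
      refine ⟨?_, ?_, ?_, ?_, ?_, ?_, ?_, ?_⟩ <;> linarith
    · obtain ⟨hst, het⟩ := hpos ht
      rw [max_eq_left hst] at hh_eq
      rw [max_eq_right (by linarith)] at hb_eq
      refine ⟨?_, ?_, ?_, ?_, ?_, ?_, ?_, ?_⟩ <;> linarith
  · rintro ⟨α, β, hα, hβ, h₁, h₂, h₃, -, -, h₄, h₅, h₆, h₇, h₈, h₉, -, -⟩
    refine ⟨le_antisymm ?_ (max_le h₁ hu), le_antisymm ?_ (max_le h₄ hh),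
      le_antisymm ?_ (max_le h₇ hb')⟩
    · rcases hβ with rfl | rfl
      · exact le_max_of_le_left (by linarith)
      · exact le_max_of_le_right (by linarith)
    · rcases hα with rfl | rfl
      · exact le_max_of_le_right (by linarith)
      · exact le_max_of_le_left (by linarith)
    · rcases hα with rfl | rfl
      · exact le_max_of_le_left (by linarith)
      · exact le_max_of_le_right (by linarith)
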